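/- Let γ ∈ (0,2), set Q := 2/γ + γ/2 and a := Q − γ = 2/γ − γ/2 > 0, and let x ≥ 0. Let (B_t)_{t≥0} be a standard Brownian motion on a probability space (Ω, P), and for δ ∈ (0,1) let T_δ := inf{t ≥ 0 : B_t + a t ≥ (1/γ) log(1/δ)}. Define β := −a + √(a² + 4x), the nonnegative root of βa + β²/2 = 2x, and Δ := β/γ. Then for every δ ∈ (0,1), E[exp(−2x T_δ)] = δ^{Δ}, so that lim_{δ→0} log E[exp(−2x T_δ)] / log δ = Δ, and Δ satisfies the KPZ relation x = (γ²/4) Δ² + (1 − γ²/4) Δ. -/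

import Mathlib

open MeasureTheory ProbabilityTheory Filter
open scoped NNReal

/-- A standard Brownian motion `(B_t)_{t ≥ 0}` on a probability space: it starts at `0`
almost surely, almost every sample path is continuous, and for `s ≤ t` the increment
`B_t − B_s` is a centered Gaussian of variance `t − s`, independent of the σ-algebra
generated by `(B_r)_{r ≤ s}`. -/
structure IsStandardBrownianMotion {Ω : Type*} [MeasurableSpace Ω]
    (P : Measure Ω) (B : ℝ≥0 → Ω → ℝ) : Prop where
  measurable : ∀ t, Measurable (B t)
  start : ∀ᵐ ω ∂P, B 0 ω = 0
  cont : ∀ᵐ ω ∂P, Continuous fun t => B t ω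
  incrLaw : ∀ s t : ℝ≥0, s ≤ t →
    Measure.map (fun ω => B t ω - B s ω) P = gaussianReal 0 (t - s)
  incrIndep : ∀ s t : ℝ≥0, s ≤ t →
    Indep (MeasurableSpace.comap (fun ω => B t ω - B s ω) inferInstance)
      (⨆ r ∈ Set.Iic s, MeasurableSpace.comap (B r) inferInstance) P

/-- The index of the first point of the grid `0, h, …, n * h` at which `f` reaches the level `L`,
or `n` if `f` stays below `L` on the grid. -/
noncomputable def gridPassage (f : ℝ≥0 → ℝ) (L : ℝ) (h : ℝ≥0) (n : ℕ) : ℕ :=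
  sInf {i : ℕ | L ≤ f (i * h) ∨ i = n}

section GridPassage

variable {f : ℝ≥0 → ℝ} {L : ℝ} {h : ℝ≥0} {n i : ℕ}

lemma gridPassage_spec (f : ℝ≥0 → ℝ) (L : ℝ) (h : ℝ≥0) (n : ℕ) :
    L ≤ f (gridPassage f L h n * h) ∨ gridPassage f L h n = n :=
  Nat.sInf_mem (s := {i : ℕ | L ≤ f (i * h) ∨ i = n}) ⟨n, Or.inr rfl⟩

lemma gridPassage_le (f : ℝ≥0 → ℝ) (L : ℝ) (h : ℝ≥0) (n : ℕ) : gridPassage f L h n ≤ n :=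
  Nat.sInf_le (Or.inr rfl)

lemma gridPassage_le_of_le (hi : L ≤ f (i * h)) : gridPassage f L h n ≤ i :=
  Nat.sInf_le (Or.inl hi)

lemma lt_of_lt_gridPassage (hi : i < gridPassage f L h n) : f (i * h) < L := by
  by_contra! hL
  exact (gridPassage_le_of_le hL).not_gt hi

lemma gridPassage_eq_of_forall_lt (H : ∀ i < n, f (i * h) < L) : gridPassage f L h n = n := by
  rcases gridPassage_spec f L h n with hL | hn
  · refine (gridPassage_le f L h n).eq_of_not_lt fun hlt => ?_
    exact (H _ hlt).not_ge hL
  · exact hn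

lemma gridPassage_succ_of_exists (H : ∃ i ≤ n, L ≤ f (i * h)) :
    gridPassage f L h (n + 1) = gridPassage f L h n := by
  have key : ∀ m, n ≤ m → L ≤ f (gridPassage f L h m * h) := fun m hm => by
    obtain ⟨i, hin, hi⟩ := H
    rcases gridPassage_spec f L h m with hL | h'
    · exact hL
    · have : i = gridPassage f L h m := by
        have := gridPassage_le_of_le (n := m) hi
        omega
      rwa [← this]
  exact le_antisymm (gridPassage_le_of_le (key n le_rfl))
    (gridPassage_le_of_le (key (n + 1) n.le_succ))

lemma le_apply_gridPassage (hin : i ≤ n) (hi : L ≤ f (i * h)) :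
    L ≤ f (gridPassage f L h n * h) := by
  rcases gridPassage_spec f L h n with hL | hn
  · exact hL
  · rwa [show gridPassage f L h n = i by have := gridPassage_le_of_le (n := n) hi; omega]

/-- A continuous path observed on a fine grid has been detected above any level lower than `L`
shortly after it reaches `L`. -/
lemma eventually_gridPassage_mul_le (hf : Continuous f) {T : ℝ≥0} {L' : ℝ} (hT : L' < f T) :
    ∀ᶠ k : ℕ in atTop,
      L' ≤ f (gridPassage f L' (1 / (k + 1)) (k * (k + 1)) * (1 / (k + 1))) ∧
      (gridPassage f L' (1 / (k + 1)) (k * (k + 1)) * (1 / (k + 1)) : ℝ≥0) ≤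
        T + 1 / (k + 1) := by
  have hone : Tendsto (fun k : ℕ => T + 1 / ((k : ℝ≥0) + 1)) atTop (nhds T) := by
    simpa using tendsto_const_nhds.add (tendsto_one_div_add_atTop_nhds_zero_nat (𝕜 := ℝ≥0))
  have hle : ∀ k : ℕ, ((⌈T * (k + 1)⌉₊ : ℝ≥0) * (1 / (k + 1))) ≤ T + 1 / (k + 1) := fun k => by
    have h1 := (Nat.ceil_lt_add_one (zero_le (a := T * ((k : ℝ≥0) + 1)))).le
    calc (⌈T * ((k : ℝ≥0) + 1)⌉₊ : ℝ≥0) * (1 / (k + 1))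
        ≤ (T * (k + 1) + 1) * (1 / (k + 1)) := by gcongr
      _ = T + 1 / (k + 1) := by field_simp
  have hge : ∀ k : ℕ, T ≤ ((⌈T * (k + 1)⌉₊ : ℝ≥0) * (1 / (k + 1))) := fun k => by
    calc T = T * (k + 1) * (1 / (k + 1)) := by field_simp
      _ ≤ _ := by gcongr; exact Nat.le_ceil _
  have hlim := tendsto_of_tendsto_of_tendsto_of_le_of_le tendsto_const_nhds hone hge hle
  filter_upwards [((hf.tendsto T).comp hlim).eventually (lt_mem_nhds hT),
    (tendsto_natCast_atTop_atTop (R := ℝ≥0)).eventually_ge_atTop T] with k hk hkT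
  have hceil : ⌈T * ((k : ℝ≥0) + 1)⌉₊ ≤ k * (k + 1) := by
    rw [Nat.ceil_le]
    push_cast
    gcongr
  refine ⟨le_apply_gridPassage hceil hk.le, le_trans ?_ (hle k)⟩
  gcongr
  exact gridPassage_le_of_le hk.le

/-- On a fine grid, a continuous path starting at or below `L` does not overshoot `L` by more than
`ε` before time `n`. -/
lemma eventually_apply_gridPassage_le (hf : Continuous f) (h0 : f 0 ≤ L) {ε : ℝ} (hε : 0 < ε)
    (n : ℕ) :
    ∀ᶠ k : ℕ in atTop,
      f (gridPassage f L (1 / (k + 1)) (n * (k + 1)) * (1 / (k + 1))) ≤ L + ε := by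
  have hu : UniformContinuousOn f (Set.Icc 0 (n : ℝ≥0)) :=
    isCompact_Icc.uniformContinuousOn_of_continuous hf.continuousOn
  obtain ⟨r, hr, H⟩ := Metric.uniformContinuousOn_iff.mp hu ε hε
  filter_upwards [(tendsto_one_div_add_atTop_nhds_zero_nat (𝕜 := ℝ)).eventually (gt_mem_nhds hr)]
    with k hk
  have hle := gridPassage_le f L (1 / (k + 1)) (n * (k + 1))
  rcases hJ : gridPassage f L (1 / (k + 1)) (n * (k + 1)) with _ | i
  · simpa using h0.trans (by linarith)
  · have hi : f (i * (1 / (k + 1))) < L := lt_of_lt_gridPassage (n := n * (k + 1)) (by omega)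
    have hbound : ∀ m : ℕ, m ≤ n * (k + 1) →
        (m * (1 / (k + 1)) : ℝ≥0) ∈ Set.Icc 0 (n : ℝ≥0) := fun m hm => by
      refine ⟨zero_le, ?_⟩
      have : (m : ℝ≥0) ≤ n * (k + 1) := by exact_mod_cast hm
      calc (m * (1 / (k + 1)) : ℝ≥0) ≤ n * (k + 1) * (1 / (k + 1)) := by gcongr
        _ = n := by field_simp
    have hd := H _ (hbound (i + 1) (by omega)) _ (hbound i (by omega)) (by
      rw [NNReal.dist_eq]
      push_cast
      rw [← sub_mul, add_sub_cancel_left, one_mul, abs_of_nonneg (by positivity)]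
      exact hk)
    rw [Real.dist_eq] at hd
    have := (abs_lt.mp hd).2
    linarith

/-- The grid passage time is at least the passage time, truncated at the end of the grid. -/
lemma min_sInf_le_gridPassage_mul :
    min (sInf {t : ℝ≥0 | L ≤ f t}) (n * h) ≤ gridPassage f L h n * h := by
  rcases gridPassage_spec f L h n with hL | hn
  · exact min_le_of_left_le (csInf_le' hL)
  · rw [hn]
    exact min_le_right _ _

end GridPassage

namespace IsStandardBrownianMotion

section Grid

variable {Ω : Type*} {B : ℝ≥0 → Ω → ℝ} {a L c d : ℝ} {h : ℝ≥0} {n : ℕ}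

/-- The σ-algebra generated by `(B r)` for `r ≤ t`. -/
abbrev history (B : ℝ≥0 → Ω → ℝ) (t : ℝ≥0) : MeasurableSpace Ω :=
  ⨆ r ∈ Set.Iic t, MeasurableSpace.comap (B r) inferInstance

lemma measurable_history {s t : ℝ≥0} (hst : s ≤ t) : Measurable[history B t] (B s) :=
  measurable_iff_comap_le.mpr
    (le_iSup₂_of_le (f := fun r (_ : r ∈ Set.Iic t) => MeasurableSpace.comap (B r) inferInstance)
      s hst le_rfl)

lemma history_mono {s t : ℝ≥0} (hst : s ≤ t) : history B s ≤ history B t :=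
  iSup₂_le fun _ hr => (measurable_history (le_trans hr hst)).comap_le

/-- The exponential process `exp (c B_t - d t)` along the grid of step `h`, stopped when
`B_t + a t` reaches the level `L`. -/
noncomputable def stoppedExp (B : ℝ≥0 → Ω → ℝ) (a L c d : ℝ) (h : ℝ≥0) (n : ℕ) (ω : Ω) :
    ENNReal :=
  ENNReal.ofReal (Real.exp
    (c * B (gridPassage (fun t => B t ω + a * t) L h n * h) ω
      - d * ↑(gridPassage (fun t => B t ω + a * t) L h n * h)))

/-- The event that `B_t + a t` is below `L` at the times `0, h, …, n * h`. -/
def aliveSet (B : ℝ≥0 → Ω → ℝ) (a L : ℝ) (h : ℝ≥0) (n : ℕ) : Set Ω :=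
  {ω | ∀ i ≤ n, B (i * h) ω + a * ↑(i * h) < L}

lemma measurableSet_aliveSet : MeasurableSet[history B (n * h)] (aliveSet B a L h n) := by
  have : aliveSet B a L h n =
      ⋂ i : ℕ, ⋂ _ : i ≤ n, {ω | B (i * h) ω + a * ↑(i * h) < L} := by
    ext ω
    simp [aliveSet]
  rw [this]
  refine MeasurableSet.iInter fun i => MeasurableSet.iInter fun hi => ?_
  have hm : Measurable[history B (n * h)] (B (i * h)) := measurable_history (by gcongr)
  exact (hm.add_const (a * ↑(i * h))) measurableSet_Iio

lemma stoppedExp_succ_of_mem {ω : Ω} (hω : ω ∈ aliveSet B a L h n) :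
    stoppedExp B a L c d h (n + 1) ω = stoppedExp B a L c d h n ω *
      ENNReal.ofReal (Real.exp (c * (B ((n + 1 : ℕ) * h) ω - B (n * h) ω) - d * h)) := by
  have h1 : gridPassage (fun t => B t ω + a * t) L h (n + 1) = n + 1 :=
    gridPassage_eq_of_forall_lt fun i hi => hω i (by omega)
  have h2 : gridPassage (fun t => B t ω + a * t) L h n = n :=
    gridPassage_eq_of_forall_lt fun i hi => hω i hi.le
  rw [stoppedExp, stoppedExp, h1, h2, ← ENNReal.ofReal_mul (Real.exp_pos _).le, ← Real.exp_add]
  congr 2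
  push_cast
  ring

lemma stoppedExp_succ_of_notMem {ω : Ω} (hω : ω ∉ aliveSet B a L h n) :
    stoppedExp B a L c d h (n + 1) ω = stoppedExp B a L c d h n ω := by
  simp only [aliveSet, Set.mem_ofPred_eq, not_forall, not_lt] at hω
  obtain ⟨i, hi, hL⟩ := hω
  rw [stoppedExp, stoppedExp, gridPassage_succ_of_exists ⟨i, hi, hL⟩]

lemma stoppedExp_zero (ω : Ω) :
    stoppedExp B a L c d h 0 ω = ENNReal.ofReal (Real.exp (c * B 0 ω)) := by
  simp [stoppedExp, Nat.le_zero.mp (gridPassage_le _ L h 0)]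

lemma stoppedExp_succ (n : ℕ) :
    stoppedExp B a L c d h (n + 1) = fun ω =>
      (aliveSet B a L h n).indicator (stoppedExp B a L c d h n) ω *
        ENNReal.ofReal (Real.exp (c * (B ((n + 1 : ℕ) * h) ω - B (n * h) ω) - d * h)) +
      (aliveSet B a L h n)ᶜ.indicator (stoppedExp B a L c d h n) ω := by
  funext ω
  by_cases hω : ω ∈ aliveSet B a L h n
  · simp [hω, stoppedExp_succ_of_mem hω]
  · simp [hω, stoppedExp_succ_of_notMem hω]

lemma measurable_stoppedExp (n : ℕ) :
    Measurable[history B (n * h)] (stoppedExp B a L c d h n) := by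
  induction n with
  | zero =>
    rw [funext stoppedExp_zero]
    have hm : Measurable[history B ((0 : ℕ) * h)] (B 0) := measurable_history zero_le
    exact ENNReal.measurable_ofReal.comp (Real.measurable_exp.comp (hm.const_mul c))
  | succ n ih =>
    have hle : (n * h : ℝ≥0) ≤ (n + 1 : ℕ) * h := by gcongr; omega
    have hmono := history_mono (B := B) hle
    have hA : MeasurableSet[history B ((n + 1 : ℕ) * h)] (aliveSet B a L h n) :=
      hmono _ measurableSet_aliveSet
    have hS : Measurable[history B ((n + 1 : ℕ) * h)] (stoppedExp B a L c d h n) :=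
      ih.mono hmono le_rfl
    have h1 : Measurable[history B ((n + 1 : ℕ) * h)] (B (n * h)) := measurable_history hle
    have h2 : Measurable[history B ((n + 1 : ℕ) * h)] (B ((n + 1 : ℕ) * h)) :=
      measurable_history le_rfl
    rw [stoppedExp_succ]
    exact ((hS.indicator hA).mul (ENNReal.measurable_ofReal.comp (Real.measurable_exp.comp
      (((h2.sub h1).const_mul c).sub_const _)))).add (hS.indicator hA.compl)

lemma stoppedExp_half_sq (ω : Ω) :
    stoppedExp B a L c (c ^ 2 / 2) h n ω = ENNReal.ofReal (Real.exp
      (c * (B (gridPassage (fun t => B t ω + a * t) L h n * h) ω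
          + a * ↑(gridPassage (fun t => B t ω + a * t) L h n * h))
        - (c * a + c ^ 2 / 2) * ↑(gridPassage (fun t => B t ω + a * t) L h n * h))) := by
  rw [stoppedExp]
  congr 2
  ring

end Grid

variable {Ω : Type*} [mΩ : MeasurableSpace Ω] {P : Measure Ω} {B : ℝ≥0 → Ω → ℝ}
  {a L c d : ℝ} {h : ℝ≥0} {n : ℕ}

lemma history_le (hB : IsStandardBrownianMotion P B) (t : ℝ≥0) : history B t ≤ mΩ :=
  iSup₂_le fun r _ => (hB.measurable r).comap_le

lemma lintegral_exp_incr [IsProbabilityMeasure P] (hB : IsStandardBrownianMotion P B)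
    {s t : ℝ≥0} (hst : s ≤ t) (c : ℝ) :
    ∫⁻ ω, ENNReal.ofReal (Real.exp (c * (B t ω - B s ω))) ∂P =
      ENNReal.ofReal (Real.exp (c ^ 2 / 2 * (t - s))) := by
  have hm : AEMeasurable (fun ω => B t ω - B s ω) P :=
    ((hB.measurable t).sub (hB.measurable s)).aemeasurable
  have hlaw := hB.incrLaw s t hst
  have hint : Integrable (fun ω => Real.exp (c * (B t ω - B s ω))) P := by
    have := integrable_exp_mul_gaussianReal (μ := 0) (v := t - s) c
    rw [← hlaw] at this
    exact this.comp_aemeasurable hm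
  rw [← ofReal_integral_eq_lintegral_ofReal hint (ae_of_all _ fun _ => (Real.exp_pos _).le)]
  have hmgf := mgf_gaussianReal hlaw c
  rw [mgf] at hmgf
  rw [hmgf, NNReal.coe_sub hst]
  congr 2
  ring

lemma lintegral_exp [IsProbabilityMeasure P] (hB : IsStandardBrownianMotion P B)
    (t : ℝ≥0) (c : ℝ) :
    ∫⁻ ω, ENNReal.ofReal (Real.exp (c * B t ω)) ∂P = ENNReal.ofReal (Real.exp (c ^ 2 / 2 * t)) := by
  have h := hB.lintegral_exp_incr (zero_le (a := t)) c
  rw [NNReal.coe_zero, sub_zero] at h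
  rw [← h]
  refine lintegral_congr_ae ?_
  filter_upwards [hB.start] with ω hω
  rw [hω, sub_zero]

/-- One step of optional stopping for the exponential process. -/
lemma lintegral_stoppedExp_succ [IsProbabilityMeasure P] (hB : IsStandardBrownianMotion P B)
    (n : ℕ) :
    ∫⁻ ω, stoppedExp B a L c d h (n + 1) ω ∂P =
      (∫⁻ ω in aliveSet B a L h n, stoppedExp B a L c d h n ω ∂P) *
        ENNReal.ofReal (Real.exp ((c ^ 2 / 2 - d) * h)) +
      ∫⁻ ω in (aliveSet B a L h n)ᶜ, stoppedExp B a L c d h n ω ∂P := by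
  have hle : (n * h : ℝ≥0) ≤ (n + 1 : ℕ) * h := by gcongr; omega
  have hA : MeasurableSet (aliveSet B a L h n) := hB.history_le _ _ measurableSet_aliveSet
  have hS : Measurable (stoppedExp B a L c d h n) :=
    (measurable_stoppedExp n).mono (hB.history_le _) le_rfl
  have hincr : Measurable (fun ω => B ((n + 1 : ℕ) * h) ω - B (n * h) ω) :=
    (hB.measurable _).sub (hB.measurable _)
  have hmean : ∫⁻ ω, ENNReal.ofReal
      (Real.exp (c * (B ((n + 1 : ℕ) * h) ω - B (n * h) ω) - d * h)) ∂P =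
      ENNReal.ofReal (Real.exp ((c ^ 2 / 2 - d) * h)) := by
    simp_rw [sub_eq_add_neg (c * _) (d * _), Real.exp_add, ENNReal.ofReal_mul (Real.exp_pos _).le]
    rw [lintegral_mul_const _ (by fun_prop), hB.lintegral_exp_incr hle,
      ← ENNReal.ofReal_mul (Real.exp_pos _).le, ← Real.exp_add]
    congr 2
    push_cast
    ring
  rw [stoppedExp_succ, lintegral_add_right _ (hS.indicator hA.compl),
    lintegral_indicator hA.compl, ← lintegral_indicator hA, ← hmean]
  congr 1
  refine lintegral_mul_eq_lintegral_mul_lintegral_of_independent_measurableSpace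
    (hB.history_le (n * h)) hincr.comap_le (hB.incrIndep _ _ hle).symm
    ((measurable_stoppedExp n).indicator measurableSet_aliveSet) ?_
  exact (ENNReal.measurable_ofReal.comp (Real.measurable_exp.comp
    ((measurable_id.const_mul c).sub_const _))).comp (comap_measurable _)

lemma lintegral_stoppedExp_bounds [IsProbabilityMeasure P] (hB : IsStandardBrownianMotion P B)
    (hcd : d ≤ c ^ 2 / 2) (n : ℕ) :
    1 ≤ ∫⁻ ω, stoppedExp B a L c d h n ω ∂P ∧
      ∫⁻ ω, stoppedExp B a L c d h n ω ∂P ≤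
        ENNReal.ofReal (Real.exp ((c ^ 2 / 2 - d) * ↑(n * h))) := by
  induction n with
  | zero =>
    have h1 : ∫⁻ ω, stoppedExp B a L c d h 0 ω ∂P = 1 := by
      simp_rw [stoppedExp_zero]
      simp [hB.lintegral_exp 0 c]
    simp [h1]
  | succ n ih =>
    have hA : MeasurableSet (aliveSet B a L h n) := hB.history_le _ _ measurableSet_aliveSet
    have hsplit := lintegral_add_compl (μ := P) (stoppedExp B a L c d h n) hA
    have hr : 1 ≤ ENNReal.ofReal (Real.exp ((c ^ 2 / 2 - d) * h)) := by
      rw [ENNReal.one_le_ofReal, Real.one_le_exp_iff]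
      exact mul_nonneg (sub_nonneg.mpr hcd) h.2
    rw [hB.lintegral_stoppedExp_succ n]
    constructor
    · refine ih.1.trans (hsplit ▸ ?_)
      gcongr
      exact le_mul_of_one_le_right zero_le hr
    · calc _ ≤ (∫⁻ ω in aliveSet B a L h n, stoppedExp B a L c d h n ω ∂P) *
            ENNReal.ofReal (Real.exp ((c ^ 2 / 2 - d) * h)) +
            (∫⁻ ω in (aliveSet B a L h n)ᶜ, stoppedExp B a L c d h n ω ∂P) *
            ENNReal.ofReal (Real.exp ((c ^ 2 / 2 - d) * h)) := by
            gcongr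
            exact le_mul_of_one_le_right zero_le hr
        _ = (∫⁻ ω, stoppedExp B a L c d h n ω ∂P) *
            ENNReal.ofReal (Real.exp ((c ^ 2 / 2 - d) * h)) := by rw [← add_mul, hsplit]
        _ ≤ _ := mul_le_mul_left ih.2 _
        _ = _ := by
            rw [← ENNReal.ofReal_mul (Real.exp_pos _).le, ← Real.exp_add]
            congr 2
            push_cast
            ring

lemma lintegral_stoppedExp [IsProbabilityMeasure P] (hB : IsStandardBrownianMotion P B) (c : ℝ)
    (n : ℕ) : ∫⁻ ω, stoppedExp B a L c (c ^ 2 / 2) h n ω ∂P = 1 := by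
  have := hB.lintegral_stoppedExp_bounds (a := a) (L := L) (h := h) (le_refl (c ^ 2 / 2)) n
  simp only [sub_self, zero_mul, Real.exp_zero, ENNReal.ofReal_one] at this
  exact le_antisymm this.2 this.1

end IsStandardBrownianMotion

lemma le_apply_sInf {f : ℝ≥0 → ℝ} {L : ℝ} (hf : Continuous f) (hne : ∃ t, L ≤ f t) :
    L ≤ f (sInf {t : ℝ≥0 | L ≤ f t}) :=
  IsClosed.csInf_mem (isClosed_le continuous_const hf) hne (OrderBot.bddBelow _)

/-- The passage time of a continuous path at level `L` is the supremum of its passage times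
strictly above the levels `L - 1 / (m + 1)`, which can be computed along a dense sequence. -/
lemma iSup_iInf_denseSeq_eq_sInf {f : ℝ≥0 → ℝ} {L : ℝ} (hf : Continuous f)
    (hne : ∃ t, L ≤ f t) :
    (⨆ m : ℕ, ⨅ q : ℕ,
      if L - 1 / (m + 1) < f (TopologicalSpace.denseSeq ℝ≥0 q)
        then (TopologicalSpace.denseSeq ℝ≥0 q : ENNReal) else ⊤) =
      ((sInf {t : ℝ≥0 | L ≤ f t} : ℝ≥0) : ENNReal) := by
  have hT := le_apply_sInf hf hne
  refine le_antisymm (iSup_le fun m => le_of_forall_gt_imp_ge_of_dense fun u hu => ?_) ?_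
  · have hpos : (0 : ℝ) < 1 / (m + 1) := by positivity
    have hopen : IsOpen {t : ℝ≥0 | L - 1 / (m + 1) < f t ∧ (t : ENNReal) < u} :=
      (isOpen_lt continuous_const hf).inter (isOpen_lt ENNReal.continuous_coe continuous_const)
    obtain ⟨_, hq, q, rfl⟩ := (TopologicalSpace.denseRange_denseSeq ℝ≥0).inter_open_nonempty _ hopen
      ⟨sInf {t : ℝ≥0 | L ≤ f t}, by linarith, hu⟩
    refine (iInf_le _ q).trans ?_
    rw [if_pos hq.1]
    exact hq.2.le
  · by_contra! hlt
    obtain ⟨r, hr, hrT⟩ := ENNReal.lt_iff_exists_nnreal_btwn.mp hlt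
    rw [ENNReal.coe_lt_coe] at hrT
    obtain ⟨s, hs, hmax⟩ := isCompact_Icc.exists_isMaxOn (s := Set.Icc (0 : ℝ≥0) r)
      ⟨0, by simp⟩ hf.continuousOn
    have hle : ∀ m : ℕ, L - 1 / ((m : ℝ) + 1) ≤ f s := fun m => by
      obtain ⟨q, hq⟩ := iInf_lt_iff.mp ((le_iSup _ m).trans_lt hr)
      split_ifs at hq with hfq
      · rw [ENNReal.coe_lt_coe] at hq
        exact hfq.le.trans (hmax ⟨zero_le, hq.le⟩)
      · simp at hq
    have hlim : Tendsto (fun m : ℕ => L - 1 / ((m : ℝ) + 1)) atTop (nhds L) := by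
      simpa using tendsto_const_nhds.sub (tendsto_one_div_add_atTop_nhds_zero_nat (𝕜 := ℝ))
    have hLs : L ≤ f s := le_of_tendsto' hlim hle
    exact (hrT.trans_le (csInf_le' hLs)).not_ge hs.2

namespace IsStandardBrownianMotion

variable {Ω : Type*} [mΩ : MeasurableSpace Ω] {P : Measure Ω} {B : ℝ≥0 → Ω → ℝ} {a L c : ℝ}

/-- Brownian motion with positive drift almost surely reaches every level. -/
lemma ae_exists_le [IsProbabilityMeasure P] (hB : IsStandardBrownianMotion P B) (ha : 0 < a)
    (L : ℝ) : ∀ᵐ ω ∂P, ∃ t : ℝ≥0, L ≤ B t ω + a * t := by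
  rw [ae_iff]
  have hbound : ∀ n : ℕ, P {ω | ¬ ∃ t : ℝ≥0, L ≤ B t ω + a * t} ≤
      ENNReal.ofReal (Real.exp (a * L - a ^ 2 / 2 * n)) := fun n => by
    have hm : Measurable fun ω => ENNReal.ofReal (Real.exp (-a * B n ω)) := by
      have := hB.measurable n
      fun_prop
    have hmarkov := mul_meas_ge_le_lintegral (μ := P) hm
      (ENNReal.ofReal (Real.exp (a ^ 2 * n - a * L)))
    rw [hB.lintegral_exp n (-a)] at hmarkov
    have hsub : {ω | ¬ ∃ t : ℝ≥0, L ≤ B t ω + a * t} ⊆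
        {ω | ENNReal.ofReal (Real.exp (a ^ 2 * n - a * L)) ≤
          ENNReal.ofReal (Real.exp (-a * B n ω))} := fun ω hω => by
      have hlt : B n ω + a * n < L := not_le.mp fun hle => hω ⟨n, by simpa using hle⟩
      refine ENNReal.ofReal_le_ofReal (Real.exp_le_exp.mpr ?_)
      nlinarith
    calc P {ω | ¬ ∃ t : ℝ≥0, L ≤ B t ω + a * t}
        ≤ ENNReal.ofReal (Real.exp (a * L - a ^ 2 * n)) *
          (ENNReal.ofReal (Real.exp (a ^ 2 * n - a * L)) *
            P {ω | ENNReal.ofReal (Real.exp (a ^ 2 * n - a * L)) ≤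
              ENNReal.ofReal (Real.exp (-a * B n ω))}) := by
          rw [← mul_assoc, ← ENNReal.ofReal_mul (Real.exp_pos _).le, ← Real.exp_add]
          simpa using measure_mono hsub
      _ ≤ ENNReal.ofReal (Real.exp (a * L - a ^ 2 * n)) *
          ENNReal.ofReal (Real.exp ((-a) ^ 2 / 2 * (n : ℝ≥0))) := by gcongr
      _ = ENNReal.ofReal (Real.exp (a * L - a ^ 2 / 2 * n)) := by
          rw [← ENNReal.ofReal_mul (Real.exp_pos _).le, ← Real.exp_add]
          congr 2
          push_cast
          ring
  have hlim : Tendsto (fun n : ℕ => ENNReal.ofReal (Real.exp (a * L - a ^ 2 / 2 * n))) atTop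
      (nhds 0) := by
    rw [← ENNReal.ofReal_zero]
    refine ENNReal.tendsto_ofReal (Real.tendsto_exp_atBot.comp ?_)
    exact tendsto_atBot_add_const_left _ _ (tendsto_neg_atTop_atBot.comp
      (tendsto_natCast_atTop_atTop.const_mul_atTop (by positivity)))
  exact le_antisymm (ge_of_tendsto' hlim hbound) zero_le

lemma ae_continuous_drift (hB : IsStandardBrownianMotion P B) (a : ℝ) :
    ∀ᵐ ω ∂P, Continuous fun t : ℝ≥0 => B t ω + a * t := by
  filter_upwards [hB.cont] with ω hω
  fun_prop

lemma aemeasurable_passage [IsProbabilityMeasure P] (hB : IsStandardBrownianMotion P B)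
    (ha : 0 < a) (L : ℝ) : AEMeasurable (fun ω => sInf {t : ℝ≥0 | L ≤ B t ω + a * t}) P := by
  set d := TopologicalSpace.denseSeq ℝ≥0
  have hV : Measurable fun ω => (⨆ m : ℕ, ⨅ q : ℕ,
      if L - 1 / (m + 1) < B (d q) ω + a * d q then (d q : ENNReal) else ⊤) := by
    refine Measurable.iSup fun m => Measurable.iInf fun q => Measurable.ite ?_
      measurable_const measurable_const
    exact measurableSet_lt measurable_const ((hB.measurable _).add_const _)
  refine ⟨_, hV.ennreal_toNNReal, ?_⟩
  filter_upwards [hB.ae_continuous_drift a, hB.ae_exists_le ha L] with ω hc hne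
  rw [iSup_iInf_denseSeq_eq_sInf hc hne, ENNReal.toNNReal_coe]

lemma lintegral_exp_passage_le_of_lt [IsProbabilityMeasure P] (hB : IsStandardBrownianMotion P B)
    (ha : 0 < a) (hc : 0 ≤ c) {L' : ℝ} (hL : L' < L) :
    ∫⁻ ω, ENNReal.ofReal (Real.exp (-(c * a + c ^ 2 / 2) *
        ↑(sInf {t : ℝ≥0 | L ≤ B t ω + a * t}))) ∂P ≤
      ENNReal.ofReal (Real.exp (-(c * L'))) := by
  set y := c * a + c ^ 2 / 2 with hy
  have hy0 : 0 ≤ y := by positivity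
  let S : ℕ → Ω → ENNReal := fun k ω => ENNReal.ofReal (Real.exp (-(c * L'))) *
    stoppedExp B a L' c (c ^ 2 / 2) (1 / (k + 1)) (k * (k + 1)) ω
  have hSm : ∀ k, Measurable (S k) := fun k =>
    ((measurable_stoppedExp _).mono (hB.history_le _) le_rfl).const_mul _
  have hSint : ∀ k, ∫⁻ ω, S k ω ∂P = ENNReal.ofReal (Real.exp (-(c * L'))) := fun k => by
    rw [lintegral_const_mul' _ _ ENNReal.ofReal_ne_top, hB.lintegral_stoppedExp, mul_one]
  calc _ ≤ ∫⁻ ω, liminf (fun k => S k ω) atTop ∂P := ?_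
    _ ≤ liminf (fun k => ∫⁻ ω, S k ω ∂P) atTop := lintegral_liminf_le hSm
    _ = _ := by simp_rw [hSint]; exact liminf_const _
  refine lintegral_mono_ae ?_
  filter_upwards [hB.ae_continuous_drift a, hB.ae_exists_le ha L] with ω hcont hne
  have hT := le_apply_sInf hcont hne
  set T := sInf {t : ℝ≥0 | L ≤ B t ω + a * t}
  have hlim : Tendsto (fun k : ℕ => ENNReal.ofReal (Real.exp (-y * ↑(T + 1 / ((k : ℝ≥0) + 1)))))
      atTop (nhds (ENNReal.ofReal (Real.exp (-y * T)))) := by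
    have hone : Tendsto (fun k : ℕ => T + 1 / ((k : ℝ≥0) + 1)) atTop (nhds T) := by
      simpa using tendsto_const_nhds.add (tendsto_one_div_add_atTop_nhds_zero_nat (𝕜 := ℝ≥0))
    have hcts : Continuous fun t : ℝ≥0 => ENNReal.ofReal (Real.exp (-y * t)) :=
      ENNReal.continuous_ofReal.comp (by fun_prop)
    exact (hcts.tendsto T).comp hone
  rw [← hlim.liminf_eq]
  refine liminf_le_liminf ?_
  filter_upwards [eventually_gridPassage_mul_le hcont (hL.trans_le hT)] with k hk
  simp only [S]
  rw [stoppedExp_half_sq, ← ENNReal.ofReal_mul (Real.exp_pos _).le, ← Real.exp_add, ← hy]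
  refine ENNReal.ofReal_le_ofReal (Real.exp_le_exp.mpr ?_)
  have h1 := mul_le_mul_of_nonneg_left hk.1 hc
  have h2 := mul_le_mul_of_nonneg_left (NNReal.coe_le_coe.mpr hk.2) hy0
  linarith

lemma lintegral_exp_passage_le [IsProbabilityMeasure P] (hB : IsStandardBrownianMotion P B)
    (ha : 0 < a) (hc : 0 ≤ c) (L : ℝ) :
    ∫⁻ ω, ENNReal.ofReal (Real.exp (-(c * a + c ^ 2 / 2) *
        ↑(sInf {t : ℝ≥0 | L ≤ B t ω + a * t}))) ∂P ≤
      ENNReal.ofReal (Real.exp (-(c * L))) := by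
  have hcts : Continuous fun L' : ℝ => ENNReal.ofReal (Real.exp (-(c * L'))) :=
      ENNReal.continuous_ofReal.comp (by fun_prop)
  refine ge_of_tendsto ((hcts.tendsto L).mono_left (nhdsWithin_le_nhds (s := Set.Iio L))) ?_
  filter_upwards [self_mem_nhdsWithin] with L' hL'
  exact hB.lintegral_exp_passage_le_of_lt ha hc hL'

/-- The square of the stopped exponential martingale controls its overshoot. -/
lemma one_le_lintegral_exp_passage_add [IsProbabilityMeasure P]
    (hB : IsStandardBrownianMotion P B) (ha : 0 < a) (hc : 0 ≤ c) (hL : 0 ≤ L)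
    {ε K : ℝ} (hε : 0 < ε) (hK : 0 < K) (n : ℕ) :
    1 ≤ ENNReal.ofReal (Real.exp (c * (L + ε))) *
        ((∫⁻ ω, ENNReal.ofReal (Real.exp (-(c * a + c ^ 2 / 2) *
          ↑(sInf {t : ℝ≥0 | L ≤ B t ω + a * t}))) ∂P) +
          ENNReal.ofReal (Real.exp (-(c * a + c ^ 2 / 2) * n))) +
      ENNReal.ofReal K⁻¹ * ENNReal.ofReal (Real.exp (c ^ 2 * n)) := by
  set y := c * a + c ^ 2 / 2 with hy
  have hy0 : 0 ≤ y := by positivity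
  let h : ℕ → ℝ≥0 := fun k => 1 / (k + 1)
  let N : ℕ → ℕ := fun k => n * (k + 1)
  have hNh : ∀ k, (N k * h k : ℝ≥0) = n := fun k => by
    simp only [N, h]
    push_cast
    field_simp
  let bad : ℕ → Set Ω := fun k =>
    {ω | ENNReal.ofReal (Real.exp (L + ε)) < stoppedExp B a L 1 (-a) (h k) (N k) ω}
  have hbad_iff : ∀ k ω, ω ∈ bad k ↔
      L + ε < B (gridPassage (fun t => B t ω + a * t) L (h k) (N k) * h k) ω +
        a * ↑(gridPassage (fun t => B t ω + a * t) L (h k) (N k) * h k) := fun k ω => by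
    simp only [bad, stoppedExp, Set.mem_ofPred_eq]
    rw [ENNReal.ofReal_lt_ofReal_iff (Real.exp_pos _), Real.exp_lt_exp, one_mul, neg_mul,
      sub_neg_eq_add]
  have hmeas : ∀ c d k, Measurable (stoppedExp B a L c d (h k) (N k)) := fun c d k =>
    (measurable_stoppedExp _).mono (hB.history_le _) le_rfl
  have hbad_meas : ∀ k, MeasurableSet (bad k) := fun k =>
    measurableSet_lt measurable_const (hmeas _ _ k)
  have hbad_lim : Tendsto (fun k => P (bad k)) atTop (nhds 0) := by
    rw [← measure_empty (μ := P)]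
    refine tendsto_measure_of_ae_tendsto_indicator_of_isFiniteMeasure _ MeasurableSet.empty
      hbad_meas ?_
    filter_upwards [hB.ae_continuous_drift a, hB.start] with ω hcont h0
    filter_upwards [eventually_apply_gridPassage_le hcont (by simpa [h0] using hL) hε n] with k hk
    simpa only [hbad_iff, Set.mem_empty_iff_false, iff_false, not_lt] using hk
  have hpt : ∀ k ω, stoppedExp B a L c (c ^ 2 / 2) (h k) (N k) ω ≤
      ENNReal.ofReal (Real.exp (c * (L + ε))) *
        (ENNReal.ofReal (Real.exp (-y * ↑(sInf {t : ℝ≥0 | L ≤ B t ω + a * t}))) +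
          ENNReal.ofReal (Real.exp (-y * n))) +
      ((bad k).indicator (fun _ => ENNReal.ofReal K) ω +
        ENNReal.ofReal K⁻¹ * stoppedExp B a L (2 * c) (c ^ 2) (h k) (N k) ω) := fun k ω => by
    by_cases hω : ω ∈ bad k
    · refine le_add_left ?_
      rw [Set.indicator_of_mem hω, stoppedExp, stoppedExp,
        ← ENNReal.ofReal_mul (inv_nonneg.mpr hK.le),
        ← ENNReal.ofReal_add hK.le (by positivity)]
      refine ENNReal.ofReal_le_ofReal ?_
      set t := gridPassage (fun t => B t ω + a * t) L (h k) (N k) * h k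
      set M := Real.exp (c * B t ω - c ^ 2 / 2 * t) with hM
      have hsq : Real.exp (2 * c * B t ω - c ^ 2 * t) = M ^ 2 := by
        rw [hM, ← Real.exp_nat_mul]
        congr 1
        push_cast
        ring
      rw [hsq]
      have : K + K⁻¹ * M ^ 2 - M = K⁻¹ * ((M - K / 2) ^ 2 + 3 / 4 * K ^ 2) := by
        field_simp
        ring
      have : 0 ≤ K⁻¹ * ((M - K / 2) ^ 2 + 3 / 4 * K ^ 2) := by positivity
      linarith
    · refine le_add_right ?_
      rw [stoppedExp_half_sq, ← hy, ← ENNReal.ofReal_add (Real.exp_pos _).le (Real.exp_pos _).le,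
        ← ENNReal.ofReal_mul (Real.exp_pos _).le]
      refine ENNReal.ofReal_le_ofReal ?_
      rw [hbad_iff, not_lt] at hω
      have hmin := min_sInf_le_gridPassage_mul (f := fun t => B t ω + a * t) (L := L) (h := h k)
        (n := N k)
      rw [hNh] at hmin
      set t := gridPassage (fun t => B t ω + a * t) L (h k) (N k) * h k
      rw [sub_eq_add_neg, Real.exp_add, ← neg_mul]
      refine mul_le_mul (Real.exp_le_exp.mpr (mul_le_mul_of_nonneg_left hω hc)) ?_
        (Real.exp_pos _).le (Real.exp_pos _).le
      rcases min_le_iff.mp hmin with hle | hle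
      · refine le_add_of_le_of_nonneg (Real.exp_le_exp.mpr ?_) (Real.exp_pos _).le
        exact mul_le_mul_of_nonpos_left (NNReal.coe_le_coe.mpr hle) (neg_nonpos.mpr hy0)
      · refine le_add_of_nonneg_of_le (Real.exp_pos _).le (Real.exp_le_exp.mpr ?_)
        exact mul_le_mul_of_nonpos_left (by exact_mod_cast NNReal.coe_le_coe.mpr hle)
          (neg_nonpos.mpr hy0)
  have hbound : ∀ k, 1 ≤ ENNReal.ofReal (Real.exp (c * (L + ε))) *
        ((∫⁻ ω, ENNReal.ofReal (Real.exp (-y *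
          ↑(sInf {t : ℝ≥0 | L ≤ B t ω + a * t}))) ∂P) +
          ENNReal.ofReal (Real.exp (-y * n))) +
      (ENNReal.ofReal K * P (bad k) +
        ENNReal.ofReal K⁻¹ * ENNReal.ofReal (Real.exp (c ^ 2 * n))) := fun k => by
    have hsecond := (hB.lintegral_stoppedExp_bounds (a := a) (L := L) (h := h k) (c := 2 * c)
      (d := c ^ 2) (by nlinarith [sq_nonneg c]) (N k)).2
    rw [hNh, show (2 * c) ^ 2 / 2 - c ^ 2 = c ^ 2 by ring, NNReal.coe_natCast] at hsecond
    have hint := lintegral_mono (μ := P) (hpt k)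
    have hsum : Measurable fun ω => (bad k).indicator (fun _ => ENNReal.ofReal K) ω +
        ENNReal.ofReal K⁻¹ * stoppedExp B a L (2 * c) (c ^ 2) (h k) (N k) ω :=
      (measurable_const.indicator (hbad_meas k)).add ((hmeas _ _ k).const_mul _)
    rw [hB.lintegral_stoppedExp, lintegral_add_right _ hsum,
      lintegral_add_right _ ((hmeas _ _ k).const_mul _),
      lintegral_const_mul' _ _ ENNReal.ofReal_ne_top, lintegral_add_right _ measurable_const,
      lintegral_const_mul' _ _ ENNReal.ofReal_ne_top, lintegral_indicator_const (hbad_meas k),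
      lintegral_const, measure_univ, mul_one] at hint
    refine hint.trans ?_
    gcongr
  have h1 := (ENNReal.Tendsto.const_mul (a := ENNReal.ofReal K) hbad_lim
    (Or.inr ENNReal.ofReal_ne_top)).add_const
      (ENNReal.ofReal K⁻¹ * ENNReal.ofReal (Real.exp (c ^ 2 * n)))
  rw [mul_zero, zero_add] at h1
  exact ge_of_tendsto' (h1.const_add _) hbound

lemma le_lintegral_exp_passage [IsProbabilityMeasure P] (hB : IsStandardBrownianMotion P B)
    (ha : 0 < a) (hc : 0 < c) (hL : 0 ≤ L) :
    ENNReal.ofReal (Real.exp (-(c * L))) ≤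
      ∫⁻ ω, ENNReal.ofReal (Real.exp (-(c * a + c ^ 2 / 2) *
        ↑(sInf {t : ℝ≥0 | L ≤ B t ω + a * t}))) ∂P := by
  have hbound := fun n : ℕ => hB.one_le_lintegral_exp_passage_add ha hc.le hL
    (ε := 1 / (n + 1)) (K := (n + 1) * Real.exp (c ^ 2 * n)) (by positivity) (by positivity) n
  set I := ∫⁻ ω, ENNReal.ofReal (Real.exp (-(c * a + c ^ 2 / 2) *
        ↑(sInf {t : ℝ≥0 | L ≤ B t ω + a * t}))) ∂P
  have hone := tendsto_one_div_add_atTop_nhds_zero_nat (𝕜 := ℝ)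
  have h1 : Tendsto (fun n : ℕ => ENNReal.ofReal (Real.exp (c * (L + 1 / ((n : ℝ) + 1))))) atTop
      (nhds (ENNReal.ofReal (Real.exp (c * L)))) := by
    have hcts : Continuous fun e : ℝ => ENNReal.ofReal (Real.exp (c * (L + e))) :=
      ENNReal.continuous_ofReal.comp (by fun_prop)
    simpa [Function.comp_def] using (hcts.tendsto 0).comp hone
  have h2 : Tendsto (fun n : ℕ => I + ENNReal.ofReal (Real.exp (-(c * a + c ^ 2 / 2) * n))) atTop
      (nhds (I + 0)) := by
    refine Tendsto.const_add _ ?_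
    rw [← ENNReal.ofReal_zero]
    refine ENNReal.tendsto_ofReal (Real.tendsto_exp_atBot.comp ?_)
    exact tendsto_natCast_atTop_atTop.const_mul_atTop_of_neg (neg_neg_of_pos (by positivity))
  have h3 : Tendsto (fun n : ℕ => ENNReal.ofReal ((n + 1) * Real.exp (c ^ 2 * n))⁻¹ *
      ENNReal.ofReal (Real.exp (c ^ 2 * n))) atTop (nhds 0) := by
    rw [← ENNReal.ofReal_zero]
    refine (ENNReal.tendsto_ofReal hone).congr fun n => ?_
    rw [← ENNReal.ofReal_mul (by positivity)]
    congr 1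
    field_simp
  have hlim := (ENNReal.Tendsto.mul h1 (Or.inl (by simp [Real.exp_pos])) h2
    (Or.inr ENNReal.ofReal_ne_top)).add h3
  have hle := ge_of_tendsto' hlim hbound
  rw [add_zero, add_zero] at hle
  calc ENNReal.ofReal (Real.exp (-(c * L)))
      ≤ ENNReal.ofReal (Real.exp (-(c * L))) * (ENNReal.ofReal (Real.exp (c * L)) * I) :=
        le_mul_of_one_le_right zero_le hle
    _ = I := by
        rw [← mul_assoc, ← ENNReal.ofReal_mul (Real.exp_pos _).le, ← Real.exp_add]
        simp

/-- The Laplace transform of the passage time of Brownian motion with positive drift. -/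
theorem integral_exp_passage [IsProbabilityMeasure P] (hB : IsStandardBrownianMotion P B)
    (ha : 0 < a) (hc : 0 ≤ c) (hL : 0 ≤ L) :
    ∫ ω, Real.exp (-(c * a + c ^ 2 / 2) * ↑(sInf {t : ℝ≥0 | L ≤ B t ω + a * t})) ∂P =
      Real.exp (-(c * L)) := by
  rcases hc.eq_or_lt with rfl | hc
  · simp
  have hm := hB.aemeasurable_passage ha L
  rw [integral_eq_lintegral_of_nonneg_ae (ae_of_all _ fun _ => (Real.exp_pos _).le)
    (Real.measurable_exp.comp_aemeasurable (hm.coe_nnreal_real.const_mul _)).aestronglyMeasurable,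
    le_antisymm (hB.lintegral_exp_passage_le ha hc.le L)
      (hB.le_lintegral_exp_passage ha hc hL), ENNReal.toReal_ofReal (Real.exp_pos _).le]

end IsStandardBrownianMotion

/-- the hitting-time computation behind the KPZ formula. With
`Q = 2/γ + γ/2`, `a = Q − γ`, `T_δ` the hitting time of level `(1/γ)log(1/δ)` by
`B_t + a t`, `β = −a + √(a² + 4x)` and `Δ = β/γ`, one has
`E[exp(−2x T_δ)] = δ^Δ` for all `δ ∈ (0,1)`, hence
`log E[exp(−2x T_δ)]/log δ → Δ` as `δ → 0`, and `Δ` satisfies the KPZ relation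
`x = (γ²/4)Δ² + (1 − γ²/4)Δ`. -/
theorem stmt15 {Ω : Type*} [MeasurableSpace Ω] (P : Measure Ω)
    [IsProbabilityMeasure P]
    (B : ℝ≥0 → Ω → ℝ) (hB : IsStandardBrownianMotion P B)
    (γ : ℝ) (hγ : γ ∈ Set.Ioo (0:ℝ) 2)
    (Q a x β Δ : ℝ)
    (hQ : Q = 2 / γ + γ / 2) (ha : a = Q - γ) (hx : 0 ≤ x)
    (hβ : β = -a + Real.sqrt (a ^ 2 + 4 * x)) (hΔ : Δ = β / γ)
    (T : ℝ → Ω → ℝ≥0)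
    (hT : T = fun δ ω =>
      sInf {t : ℝ≥0 | (1 / γ) * Real.log (1 / δ) ≤ B t ω + a * t}) :
    (0 < a) ∧
    (∀ δ : ℝ, δ ∈ Set.Ioo (0:ℝ) 1 →
      ∫ ω, Real.exp (-(2 * x) * (T δ ω : ℝ)) ∂P = δ ^ Δ) ∧
    Tendsto (fun δ : ℝ =>
        Real.log (∫ ω, Real.exp (-(2 * x) * (T δ ω : ℝ)) ∂P) / Real.log δ)
      (nhdsWithin 0 (Set.Ioo (0:ℝ) 1)) (nhds Δ) ∧
    x = γ ^ 2 / 4 * Δ ^ 2 + (1 - γ ^ 2 / 4) * Δ := by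
  obtain ⟨hγ0, hγ2⟩ := hγ
  have ha' : a = 2 / γ - γ / 2 := by rw [ha, hQ]; ring
  have hapos : 0 < a := by
    rw [ha', show 2 / γ - γ / 2 = (2 - γ) * (2 + γ) / (2 * γ) by field_simp; ring]
    have : 0 < 2 - γ := by linarith
    positivity
  have hsq : Real.sqrt (a ^ 2 + 4 * x) ^ 2 = a ^ 2 + 4 * x := Real.sq_sqrt (by positivity)
  have hβ0 : 0 ≤ β := by
    have : a ≤ Real.sqrt (a ^ 2 + 4 * x) := Real.le_sqrt_of_sq_le (by linarith)
    linarith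
  have hβx : β * a + β ^ 2 / 2 = 2 * x := by
    rw [hβ]
    linear_combination hsq / 2
  have hlaw : ∀ δ : ℝ, δ ∈ Set.Ioo (0:ℝ) 1 →
      ∫ ω, Real.exp (-(2 * x) * (T δ ω : ℝ)) ∂P = δ ^ Δ := fun δ hδ => by
    have hL : 0 ≤ (1 / γ) * Real.log (1 / δ) :=
      mul_nonneg (by positivity) (Real.log_nonneg (one_le_one_div hδ.1 hδ.2.le))
    simp only [hT]
    rw [← hβx, hB.integral_exp_passage hapos hβ0 hL, Real.rpow_def_of_pos hδ.1, hΔ, one_div δ,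
      Real.log_inv]
    congr 1
    ring
  refine ⟨hapos, hlaw, ?_, ?_⟩
  · refine tendsto_const_nhds.congr' ?_
    filter_upwards [self_mem_nhdsWithin] with δ hδ
    rw [hlaw δ hδ, Real.log_rpow hδ.1, mul_div_cancel_right₀]
    exact (Real.log_neg hδ.1 hδ.2).ne
  · rw [hΔ]
    rw [ha'] at hβx
    field_simp
    field_simp at hβx
    linear_combination -hβx
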